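/- arXiv:2310.12827 — 7 statements merged into one kernel-verified Lean document; each statement's English description precedes it below -/
import Mathlib

section
/- Basic adaptive sequential composition for P-PRzCDP (Lemma 2): Let T be a record set and P₁, P₂ : T → [0,∞) policy functions. Let M₁ be a mechanism mapping databases over T to probability measures on a measurable space Y₁ that satisfies P₁-PRzCDP. For each database D over T, let κ_D : Y₁ → (probability measures on Y₂) be a Markov kernel, and suppose that for every fixed y ∈ Y₁ the mechanism D ↦ κ_D(y) satisfies P₂-PRzCDP. Then the composed mechanism M₃ defined by M₃(D) = M₁(D) ⊗ κ_D (the joint law on Y₁ × Y₂ of a sample y from M₁(D) followed by a sample from κ_D(y)) satisfies P-PRzCDP for the policy function P(r) = P₁(r) + P₂(r). -/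
open MeasureTheory ProbabilityTheory
open scoped Classical NNReal

/-- Rényi divergence of order `α` between two measures. -/
noncomputable def renyiDiv {X : Type*} [MeasurableSpace X] (α : ℝ) (P Q : Measure X) : EReal :=
  if P ≪ Q then (((α - 1)⁻¹ : ℝ) : EReal) * ENNReal.log (∫⁻ x, P.rnDeriv Q x ^ α ∂Q)
  else ⊤

/-- Databases `D` and `D'` differ in the single record `r`. -/
def Neighbors {T : Type*} (D D' : Multiset T) (r : T) : Prop :=
  D' = r ::ₘ D ∨ D = r ::ₘ D'

/-- Per-record zero-concentrated differential privacy with policy function `P`. -/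
def PRzCDP {T Y : Type*} [MeasurableSpace Y] (M : Multiset T → Measure Y) (P : T → ℝ) : Prop :=
  ∀ α : ℝ, 1 < α → ∀ (D D' : Multiset T) (r : T), Neighbors D D' r →
    renyiDiv α (M D) (M D') ≤ ((α * P r : ℝ) : EReal)

/-- Zero-concentrated differential privacy with privacy-loss parameter `ρ`. -/
def zCDP {T Y : Type*} [MeasurableSpace Y] (M : Multiset T → Measure Y) (ρ : ℝ) : Prop :=
  ∀ α : ℝ, 1 < α → ∀ (D D' : Multiset T) (r : T), Neighbors D D' r →
    renyiDiv α (M D) (M D') ≤ ((ρ * α : ℝ) : EReal)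

/-- For `α > 1`, a real upper bound on the Rényi divergence amounts to absolute continuity together
with a bound on the `α`-th moment of the density. -/
lemma renyiDiv_le_coe_iff {X : Type*} [MeasurableSpace X] {α : ℝ} (hα : 1 < α) {P Q : Measure X}
    {c : ℝ} :
    renyiDiv α P Q ≤ (c : EReal) ↔
      P ≪ Q ∧ ∫⁻ x, P.rnDeriv Q x ^ α ∂Q ≤ ENNReal.ofReal (Real.exp ((α - 1) * c)) := by
  have hα' : 0 < α - 1 := sub_pos.2 hα
  unfold renyiDiv
  split_ifs with h
  · have hc : (c : EReal) = ENNReal.log (ENNReal.ofReal (Real.exp c)) := by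
      rw [← EReal.exp_coe, EReal.log_exp]
    rw [← ENNReal.log_rpow, hc, ENNReal.log_le_log_iff, ENNReal.rpow_inv_le_iff hα',
      ENNReal.ofReal_rpow_of_pos (Real.exp_pos c), ← Real.exp_mul, mul_comm c]
    simp [h]
  · simp [h]

/-- Hölder's inequality for a change of measure: a moment bound on the density controls integrals
with respect to the first measure. -/
lemma lintegral_le_of_lintegral_rnDeriv_rpow_le {X : Type*} [MeasurableSpace X] {α β : ℝ}
    (hαβ : α.HolderConjugate β) {P Q : Measure X} [P.HaveLebesgueDecomposition Q] (hPQ : P ≪ Q)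
    {C : ENNReal} (hC : ∫⁻ x, P.rnDeriv Q x ^ α ∂Q ≤ C) {g : X → ENNReal} (hg : Measurable g) :
    ∫⁻ x, g x ∂P ≤ C ^ (1 / α) * (∫⁻ x, g x ^ β ∂Q) ^ (1 / β) := by
  rw [← lintegral_rnDeriv_mul hPQ hg.aemeasurable]
  refine (ENNReal.lintegral_mul_le_Lp_mul_Lq Q hαβ
    (Measure.measurable_rnDeriv P Q).aemeasurable hg.aemeasurable).trans ?_
  gcongr
  exact hαβ.one_div_nonneg

/-- Converse Hölder inequality: the bound on integrals forces the moment bound on the density. -/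
lemma lintegral_rnDeriv_rpow_le_of_lintegral_le {X : Type*} [MeasurableSpace X] {α β : ℝ}
    (hαβ : α.HolderConjugate β) {P Q : Measure X} [P.HaveLebesgueDecomposition Q]
    [IsFiniteMeasure Q] (hPQ : P ≪ Q) {C : ENNReal}
    (h : ∀ g : X → ENNReal, Measurable g →
      ∫⁻ x, g x ∂P ≤ C ^ (1 / α) * (∫⁻ x, g x ^ β ∂Q) ^ (1 / β)) :
    ∫⁻ x, P.rnDeriv Q x ^ α ∂Q ≤ C := by
  set f := P.rnDeriv Q
  have hf : Measurable f := Measure.measurable_rnDeriv P Q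
  have hmin (n : ℕ) : Measurable fun x => min (f x) (n : ENNReal) := hf.min measurable_const
  have htrunc (n : ℕ) : ∫⁻ x, min (f x) (n : ENNReal) ^ α ∂Q ≤ C := by
    set I := ∫⁻ x, min (f x) (n : ENNReal) ^ α ∂Q
    have hI_top : I ≠ ⊤ := by
      refine ((lintegral_mono fun x => ENNReal.rpow_le_rpow (min_le_right (f x) (n : ENNReal))
        hαβ.nonneg).trans_lt ?_).ne
      rw [lintegral_const]
      exact ENNReal.mul_lt_top (ENNReal.rpow_lt_top_of_nonneg hαβ.nonneg (by simp))
        (measure_lt_top _ _)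
    by_cases hI : I = 0
    · simp [hI]
    have hle : I ≤ C ^ (1 / α) * I ^ (1 / β) := by
      calc I ≤ ∫⁻ x, f x * min (f x) (n : ENNReal) ^ (α - 1) ∂Q := by
            refine lintegral_mono fun x => ?_
            calc min (f x) (n : ENNReal) ^ α
                = min (f x) (n : ENNReal) * min (f x) (n : ENNReal) ^ (α - 1) := by
                  nth_rw 2 [← ENNReal.rpow_one (min (f x) (n : ENNReal))]
                  rw [← ENNReal.rpow_add_of_nonneg _ _ zero_le_one hαβ.sub_one_pos.le,
                    add_sub_cancel]
              _ ≤ _ := by gcongr; exact min_le_left _ _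
        _ = ∫⁻ x, min (f x) (n : ENNReal) ^ (α - 1) ∂P :=
            lintegral_rnDeriv_mul hPQ ((hmin n).pow_const _).aemeasurable
        _ ≤ _ := h _ ((hmin n).pow_const _)
        _ = _ := by simp_rw [← ENNReal.rpow_mul, hαβ.sub_one_mul_conj]; rfl
    have hsplit : I = I ^ (1 / α) * I ^ (1 / β) := by
      rw [← ENNReal.rpow_add _ _ hI hI_top, one_div, one_div, hαβ.inv_add_inv_eq_one,
        ENNReal.rpow_one]
    nth_rw 1 [hsplit] at hle
    rw [ENNReal.mul_le_mul_iff_left (by simp [hI, hI_top]) (by simp [hI, hI_top]),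
      ENNReal.rpow_le_rpow_iff hαβ.one_div_pos] at hle
    exact hle
  refine le_of_tendsto' (lintegral_tendsto_of_tendsto_of_monotone
    (fun n => ((hmin n).pow_const α).aemeasurable) (.of_forall fun x => ?_)
    (.of_forall fun x => ?_)) htrunc
  · intro m n hmn
    have := hαβ.nonneg
    dsimp only
    gcongr
  · refine (ENNReal.continuous_rpow_const.tendsto _).comp ?_
    have := (tendsto_const_nhds (x := f x)).min ENNReal.tendsto_nat_nhds_top
    simpa using this

/-- Moment bounds on densities multiply under composition of a measure with a kernel. The density of
the composition need not factor pointwise, as the second space need not be countably generated. -/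
lemma lintegral_rnDeriv_compProd_rpow_le {X Y : Type*} [MeasurableSpace X] [MeasurableSpace Y]
    {α : ℝ} (hα : 1 < α) {μ ν : Measure X} [IsFiniteMeasure μ] [IsFiniteMeasure ν]
    {κ η : Kernel X Y} [IsFiniteKernel κ] [IsFiniteKernel η] (hμν : μ ≪ ν) (hκη : ∀ x, κ x ≪ η x)
    {C₁ C₂ : ENNReal} (hC₁ : ∫⁻ x, μ.rnDeriv ν x ^ α ∂ν ≤ C₁)
    (hC₂ : ∀ x, ∫⁻ y, (κ x).rnDeriv (η x) y ^ α ∂(η x) ≤ C₂) :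
    ∫⁻ p, (μ ⊗ₘ κ).rnDeriv (ν ⊗ₘ η) p ^ α ∂(ν ⊗ₘ η) ≤ C₁ * C₂ := by
  have hαβ := Real.HolderConjugate.conjExponent hα
  set β := α.conjExponent
  refine lintegral_rnDeriv_rpow_le_of_lintegral_le hαβ
    (Measure.AbsolutelyContinuous.compProd hμν (.of_forall hκη)) fun g hg => ?_
  have hgβ : Measurable fun p => g p ^ β := hg.pow_const β
  have hG : Measurable fun x => ∫⁻ y, g (x, y) ^ β ∂(η x) := hgβ.lintegral_kernel_prod_right'
  rw [Measure.lintegral_compProd hg, Measure.lintegral_compProd hgβ]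
  calc ∫⁻ x, ∫⁻ y, g (x, y) ∂(κ x) ∂μ
      ≤ ∫⁻ x, C₂ ^ (1 / α) * (∫⁻ y, g (x, y) ^ β ∂(η x)) ^ (1 / β) ∂μ :=
        lintegral_mono fun x => lintegral_le_of_lintegral_rnDeriv_rpow_le hαβ (hκη x) (hC₂ x)
          (hg.comp measurable_prodMk_left)
    _ = C₂ ^ (1 / α) * ∫⁻ x, (∫⁻ y, g (x, y) ^ β ∂(η x)) ^ (1 / β) ∂μ :=
        lintegral_const_mul _ (hG.pow_const _)
    _ ≤ C₂ ^ (1 / α) * (C₁ ^ (1 / α) *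
          (∫⁻ x, ((∫⁻ y, g (x, y) ^ β ∂(η x)) ^ (1 / β)) ^ β ∂ν) ^ (1 / β)) := by
        gcongr
        exact lintegral_le_of_lintegral_rnDeriv_rpow_le hαβ hμν hC₁ (hG.pow_const _)
    _ = (C₁ * C₂) ^ (1 / α) * (∫⁻ x, ∫⁻ y, g (x, y) ^ β ∂(η x) ∂ν) ^ (1 / β) := by
        simp_rw [← ENNReal.rpow_mul, one_div_mul_cancel hαβ.symm.ne_zero, ENNReal.rpow_one]
        rw [ENNReal.mul_rpow_of_nonneg _ _ hαβ.one_div_nonneg, ← mul_assoc,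
          mul_comm (C₂ ^ (1 / α))]

/-- Basic adaptive sequential composition for P-PRzCDP (Lemma 2). -/
theorem przcdp_adaptive_sequential_composition {T Y₁ Y₂ : Type*}
    [MeasurableSpace Y₁] [MeasurableSpace Y₂]
    (P₁ P₂ : T → ℝ) (hP₁ : ∀ r, 0 ≤ P₁ r) (hP₂ : ∀ r, 0 ≤ P₂ r)
    (M₁ : Multiset T → Measure Y₁) (hM₁prob : ∀ D, IsProbabilityMeasure (M₁ D))
    (hM₁ : PRzCDP M₁ P₁)
    (κ : Multiset T → Kernel Y₁ Y₂) (hκ : ∀ D, IsMarkovKernel (κ D))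
    (hκP : ∀ y : Y₁, PRzCDP (fun D => κ D y) P₂) :
    PRzCDP (fun D => (M₁ D) ⊗ₘ (κ D)) (fun r => P₁ r + P₂ r) := by
  intro α hα D D' r hr
  have := hM₁prob D
  have := hM₁prob D'
  have := hκ D
  have := hκ D'
  obtain ⟨hM, hMC⟩ := (renyiDiv_le_coe_iff hα).1 (hM₁ α hα D D' r hr)
  have hκC y := (renyiDiv_le_coe_iff hα).1 (hκP y α hα D D' r hr)
  refine (renyiDiv_le_coe_iff hα).2
    ⟨Measure.AbsolutelyContinuous.compProd hM (.of_forall fun y => (hκC y).1), ?_⟩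
  rw [mul_add, mul_add, Real.exp_add, ENNReal.ofReal_mul (Real.exp_pos _).le]
  exact lintegral_rnDeriv_compProd_rpow_le hα hM (fun y => (hκC y).1) hMC fun y => (hκC y).2
end

section
/- Parallel composition for P-PRzCDP (Lemma 3): Let T be a record set, P : T → [0,∞) a policy function, and let {C_j}_{j ∈ J} be a partition of T indexed by a countable set J (the C_j are pairwise disjoint and their union is T). For each j ∈ J, let M_j be a mechanism mapping databases whose records all lie in C_j to probability measures on a measurable space Y_j, and suppose each M_j satisfies P-PRzCDP (restricted to such databases). Define the mechanism M by M(D) = the product probability measure ⊗_{j∈J} M_j(D_j) on ∏_{j∈J} Y_j, where D_j is the sub-multiset of D consisting of the records of D lying in C_j. Then M satisfies P-PRzCDP. -/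
open MeasureTheory ProbabilityTheory
open scoped Classical NNReal

theorem absolutelyContinuous_of_renyiDiv_le {X : Type*} [MeasurableSpace X] {α c : ℝ}
    {P Q : Measure X} (h : renyiDiv α P Q ≤ (c : EReal)) : P ≪ Q := by
  by_contra hPQ
  rw [renyiDiv, if_neg hPQ, top_le_iff] at h
  exact EReal.coe_ne_top c h

theorem infinitePi_eq_withDensity_of_eq_of_ne {ι : Type*} {X : ι → Type*}
    [∀ i, MeasurableSpace (X i)] {μ ν : ∀ i, Measure (X i)}
    [∀ i, IsProbabilityMeasure (μ i)] [∀ i, IsProbabilityMeasure (ν i)] (i : ι)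
    (heq : ∀ j, j ≠ i → μ j = ν j) (hac : μ i ≪ ν i) :
    Measure.infinitePi μ =
      (Measure.infinitePi ν).withDensity fun f ↦ (μ i).rnDeriv (ν i) (f i) := by
  symm
  refine Measure.eq_infinitePi _ fun s t ht ↦ ?_
  have hprod : ∏ j ∈ s, μ j (t j) =
      (if i ∈ s then μ i (t i) else 1) * ∏ j ∈ s.erase i, ν j (t j) := by
    have herase : ∏ j ∈ s.erase i, ν j (t j) = ∏ j ∈ s.erase i, μ j (t j) :=
      Finset.prod_congr rfl fun j hj ↦ by rw [heq j (Finset.ne_of_mem_erase hj)]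
    rw [herase]
    split_ifs with hi
    · rw [Finset.mul_prod_erase s (fun j ↦ μ j (t j)) hi]
    · rw [Finset.erase_eq_of_notMem hi, one_mul]
  set A : Set (∀ j, X j) := Set.pi (s.erase i) t
  have hA : MeasurableSet A :=
    MeasurableSet.pi (Finset.countable_toSet _) fun j _ ↦ ht j
  set B : Set (X i) := if i ∈ s then t i else Set.univ
  have hB : MeasurableSet B := by
    by_cases hi : i ∈ s <;> simp [B, hi, ht]
  have hpi : Set.pi s t = (fun f : ∀ j, X j ↦ f i) ⁻¹' B ∩ A := by
    ext f
    by_cases hi : i ∈ s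
    · simp only [A, B, hi, if_true, Set.mem_pi, Set.mem_inter_iff, Set.mem_preimage,
        Finset.mem_coe, Finset.mem_erase]
      grind
    · simp [A, B, hi]
  have hmap : ((Measure.infinitePi ν).restrict A).map (fun f ↦ f i) =
      (∏ j ∈ s.erase i, ν j (t j)) • ν i := by
    ext E hE
    rw [Measure.map_apply (measurable_pi_apply i) hE,
      Measure.restrict_apply (measurable_pi_apply i hE)]
    have hset : (fun f : ∀ j, X j ↦ f i) ⁻¹' E ∩ A =
        Set.pi (insert i (s.erase i) : Finset ι) (Function.update t i E) := by
      ext f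
      simp only [A, Set.mem_pi, Set.mem_inter_iff, Set.mem_preimage, Finset.coe_insert,
        Set.forall_mem_insert, Function.update_self, Finset.mem_coe]
      refine and_congr_right fun _ ↦ forall₂_congr fun j hj ↦ ?_
      rw [Function.update_of_ne (Finset.ne_of_mem_erase hj)]
    rw [hset, Measure.infinitePi_pi, Finset.prod_insert (Finset.notMem_erase i s),
      Function.update_self, Measure.smul_apply, smul_eq_mul, mul_comm]
    · congr 1
      refine Finset.prod_congr rfl fun j hj ↦ ?_
      rw [Function.update_of_ne (Finset.ne_of_mem_erase hj)]
    · intro j _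
      by_cases hj : j = i
      · subst hj
        simpa using hE
      · simpa [Function.update_of_ne hj] using ht j
  have hBval : μ i B = if i ∈ s then μ i (t i) else 1 := by
    by_cases hi : i ∈ s <;> simp [B, hi]
  rw [hprod, ← hBval, hpi,
    withDensity_apply _ ((measurable_pi_apply i hB).inter hA),
    ← Measure.restrict_restrict (measurable_pi_apply i hB),
    ← setLIntegral_map hB (Measure.measurable_rnDeriv _ _) (measurable_pi_apply i), hmap,
    Measure.restrict_smul, lintegral_smul_measure, Measure.setLIntegral_rnDeriv hac,
    smul_eq_mul, mul_comm]

theorem renyiDiv_infinitePi_of_eq_of_ne {ι : Type*} {X : ι → Type*}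
    [∀ i, MeasurableSpace (X i)] {μ ν : ∀ i, Measure (X i)}
    [∀ i, IsProbabilityMeasure (μ i)] [∀ i, IsProbabilityMeasure (ν i)] (α : ℝ) (i : ι)
    (heq : ∀ j, j ≠ i → μ j = ν j) (hac : μ i ≪ ν i) :
    renyiDiv α (Measure.infinitePi μ) (Measure.infinitePi ν) = renyiDiv α (μ i) (ν i) := by
  have hdensity := infinitePi_eq_withDensity_of_eq_of_ne i heq hac
  have hmeas := Measure.measurable_rnDeriv (μ i) (ν i)
  have hacPi : Measure.infinitePi μ ≪ Measure.infinitePi ν :=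
    hdensity ▸ withDensity_absolutelyContinuous _ _
  have hderiv : (Measure.infinitePi μ).rnDeriv (Measure.infinitePi ν)
      =ᵐ[Measure.infinitePi ν] fun f ↦ (μ i).rnDeriv (ν i) (f i) := by
    rw [hdensity]
    exact Measure.rnDeriv_withDensity _ (hmeas.comp (measurable_pi_apply i))
  rw [renyiDiv, renyiDiv, if_pos hac, if_pos hacPi,
    lintegral_congr_ae (hderiv.mono fun f hf ↦ congrArg (· ^ α) hf),
    ← (measurePreserving_eval_infinitePi ν i).lintegral_comp (hmeas.pow_const α)]

/-- Parallel composition for P-PRzCDP (Lemma 3).  The product measure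
`⊗_{j∈J} M_j(D_j)` over the countable index set `J` is characterized by its values on
measurable cylinder sets. -/
theorem przcdp_parallel_composition {T : Type*} {J : Type*} [Countable J]
    {Y : J → Type*} [∀ j, MeasurableSpace (Y j)]
    (P : T → ℝ) (hP : ∀ r, 0 ≤ P r)
    (C : J → Set T) [∀ j, DecidablePred (· ∈ C j)]
    (hdisj : Pairwise (Function.onFun Disjoint C)) (hcover : (⋃ j, C j) = Set.univ)
    (M : ∀ j, Multiset T → Measure (Y j))
    (hMprob : ∀ j D, IsProbabilityMeasure (M j D))
    (hM : ∀ j, ∀ α : ℝ, 1 < α → ∀ (D D' : Multiset T) (r : T),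
      (∀ s ∈ D, s ∈ C j) → (∀ s ∈ D', s ∈ C j) → Neighbors D D' r →
      renyiDiv α (M j D) (M j D') ≤ ((α * P r : ℝ) : EReal))
    (Mfull : Multiset T → Measure (∀ j, Y j))
    (hMfullprob : ∀ D, IsProbabilityMeasure (Mfull D))
    (hMfull : ∀ (D : Multiset T) (I : Finset J) (s : ∀ j, Set (Y j)),
      (∀ j, MeasurableSet (s j)) →
      Mfull D {f | ∀ j ∈ I, f j ∈ s j} =
        ∏ j ∈ I, M j (D.filter (· ∈ C j)) (s j)) :
    PRzCDP Mfull P := by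
  have hfull (D : Multiset T) :
      Mfull D = Measure.infinitePi fun j ↦ M j (D.filter (· ∈ C j)) := by
    refine Measure.eq_infinitePi _ fun I s hs ↦ ?_
    rw [← hMfull D I s hs]
    rfl
  intro α hα D D' r hr
  obtain ⟨i, hi⟩ : ∃ i, r ∈ C i := Set.mem_iUnion.mp (hcover ▸ Set.mem_univ r)
  have hfilter (j : J) (hj : j ≠ i) : D.filter (· ∈ C j) = D'.filter (· ∈ C j) := by
    have hrj : r ∉ C j := fun h ↦ Set.disjoint_left.mp (hdisj hj) h hi
    rcases hr with rfl | rfl <;> simp [Multiset.filter_cons_of_neg, hrj]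
  have hneighbors : Neighbors (D.filter (· ∈ C i)) (D'.filter (· ∈ C i)) r := by
    rcases hr with rfl | rfl
    · exact Or.inl (Multiset.filter_cons_of_pos _ hi)
    · exact Or.inr (Multiset.filter_cons_of_pos _ hi)
  have hle := hM i α hα _ _ r (fun s hs ↦ (Multiset.mem_filter.mp hs).2)
    (fun s hs ↦ (Multiset.mem_filter.mp hs).2) hneighbors
  rw [hfull, hfull, renyiDiv_infinitePi_of_eq_of_ne α i (fun j hj ↦ by rw [hfilter j hj])
    (absolutelyContinuous_of_renyiDiv_le hle)]
  exact hle
end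

section
/- Mixed zCDP/PRzCDP composition (combining Lemma 10 with sequential composition, as used for multiple aggregations): Let T be a record set. Let M₁ be a mechanism mapping databases over T to probability measures on a measurable space Y₁ satisfying ρ-zCDP, and let M₂ be a mechanism mapping databases over T to probability measures on a measurable space Y₂ satisfying P₂-PRzCDP for a policy function P₂ : T → [0,∞). Then the joint mechanism M(D) = M₁(D) ⊗ M₂(D) (the product probability measure on Y₁ × Y₂) satisfies P-PRzCDP for the policy function P(r) = ρ + P₂(r). -/
open MeasureTheory ProbabilityTheory
open scoped Classical NNReal

/-- The Radon-Nikodym derivative of a product measure is the product of the derivatives. -/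
theorem rnDeriv_prod_ae_eq {X Y : Type*} [MeasurableSpace X] [MeasurableSpace Y]
    {P Q : Measure X} {P' Q' : Measure Y} [SigmaFinite P] [SigmaFinite Q]
    [SigmaFinite P'] [SigmaFinite Q'] (h : P ≪ Q) (h' : P' ≪ Q') :
    (P.prod P').rnDeriv (Q.prod Q') =ᵐ[Q.prod Q']
      fun z => P.rnDeriv Q z.1 * P'.rnDeriv Q' z.2 := by
  have hdensity : P.prod P' =
      (Q.prod Q').withDensity fun z => P.rnDeriv Q z.1 * P'.rnDeriv Q' z.2 := by
    rw [← prod_withDensity (P.measurable_rnDeriv Q) (P'.measurable_rnDeriv Q'),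
      Measure.withDensity_rnDeriv_eq P Q h, Measure.withDensity_rnDeriv_eq P' Q' h']
  conv_lhs => rw [hdensity]
  exact Measure.rnDeriv_withDensity _ (by fun_prop)

/-- Rényi divergence is additive on products of absolutely continuous measures. -/
theorem renyiDiv_prod {X Y : Type*} [MeasurableSpace X] [MeasurableSpace Y] {α : ℝ} (hα : 1 < α)
    {P Q : Measure X} {P' Q' : Measure Y} [SigmaFinite P] [SigmaFinite Q]
    [SigmaFinite P'] [SigmaFinite Q'] (h : P ≪ Q) (h' : P' ≪ Q') :
    renyiDiv α (P.prod P') (Q.prod Q') = renyiDiv α P Q + renyiDiv α P' Q' := by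
  have hint : ∫⁻ z, (P.prod P').rnDeriv (Q.prod Q') z ^ α ∂(Q.prod Q') =
      (∫⁻ x, P.rnDeriv Q x ^ α ∂Q) * ∫⁻ y, P'.rnDeriv Q' y ^ α ∂Q' := by
    rw [← lintegral_prod_mul (by fun_prop) (by fun_prop)]
    refine lintegral_congr_ae ?_
    filter_upwards [rnDeriv_prod_ae_eq h h'] with z hz
    rw [hz, ENNReal.mul_rpow_of_nonneg _ _ (by linarith)]
  have hc : (0 : ℝ) ≤ (α - 1)⁻¹ := inv_nonneg.mpr (by linarith)
  rw [renyiDiv, renyiDiv, renyiDiv, if_pos h, if_pos h', if_pos (h.prod h'), hint,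
    ENNReal.log_mul_add, EReal.left_distrib_of_nonneg_of_ne_top (by exact_mod_cast hc)
      (EReal.coe_ne_top _)]

/-- Mixed zCDP/PRzCDP composition. -/
theorem mixed_zcdp_przcdp_composition {T Y₁ Y₂ : Type*}
    [MeasurableSpace Y₁] [MeasurableSpace Y₂]
    (ρ : ℝ) (hρ : 0 ≤ ρ) (P₂ : T → ℝ) (hP₂ : ∀ r, 0 ≤ P₂ r)
    (M₁ : Multiset T → Measure Y₁) (hM₁prob : ∀ D, IsProbabilityMeasure (M₁ D))
    (hM₁ : zCDP M₁ ρ)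
    (M₂ : Multiset T → Measure Y₂) (hM₂prob : ∀ D, IsProbabilityMeasure (M₂ D))
    (hM₂ : PRzCDP M₂ P₂) :
    PRzCDP (fun D => (M₁ D).prod (M₂ D)) (fun r => ρ + P₂ r) := by
  intro α hα D D' r hr
  have h₁ := hM₁ α hα D D' r hr
  have h₂ := hM₂ α hα D D' r hr
  rw [renyiDiv_prod hα (absolutelyContinuous_of_renyiDiv_le h₁)
    (absolutelyContinuous_of_renyiDiv_le h₂), mul_add, mul_comm α ρ, EReal.coe_add]
  exact add_le_add h₁ h₂
end

section
/- Weak triangle inequality for Rényi divergence (Lemma 5.2 of Bun–Steinke, used in the group-privacy proofs): Let P, Q, R be probability measures on a common measurable space, and let α, k ∈ (1,∞). Then D_α(P‖Q) ≤ (kα/(kα−1)) · D_{(kα−1)/(k−1)}(P‖R) + D_{kα}(R‖Q). -/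
open MeasureTheory ProbabilityTheory
open scoped Classical NNReal

/-- A nonzero measure has Rényi divergence different from `⊥`. -/
theorem renyiDiv_ne_bot {X : Type*} [MeasurableSpace X] (P Q : Measure X) [NeZero P]
    [P.HaveLebesgueDecomposition Q] {α : ℝ} (hα : 1 < α) : renyiDiv α P Q ≠ ⊥ := by
  unfold renyiDiv
  split_ifs with h
  · have hpos : 0 < (α - 1)⁻¹ := inv_pos.2 (sub_pos.2 hα)
    have hint : ∫⁻ x, P.rnDeriv Q x ^ α ∂Q ≠ 0 := by
      intro h0
      rw [lintegral_eq_zero_iff ((Measure.measurable_rnDeriv P Q).pow_const α)] at h0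
      have hzero : P.rnDeriv Q =ᵐ[Q] 0 := by
        filter_upwards [h0] with x hx
        exact (ENNReal.rpow_eq_zero_iff_of_pos (by linarith)).1 hx
      refine NeZero.ne P ?_
      rw [← Measure.withDensity_rnDeriv_eq P Q h, withDensity_congr_ae hzero, withDensity_zero]
    rw [EReal.mul_ne_bot]
    refine ⟨Or.inl (EReal.coe_ne_bot _), Or.inr ?_, Or.inl (EReal.coe_ne_top _),
      Or.inl (EReal.coe_nonneg.2 hpos.le)⟩
    rwa [Ne, ENNReal.log_eq_bot_iff]
  · exact top_ne_bot

/-- Hölder's inequality for the moments of a composite Radon–Nikodym derivative. -/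
theorem lintegral_rnDeriv_rpow_le_mul {X : Type*} [MeasurableSpace X] (P Q R : Measure X)
    [SigmaFinite P] [SigmaFinite Q] [SigmaFinite R] (hPR : P ≪ R) (hRQ : R ≪ Q)
    {α p q : ℝ} (hpq : p.HolderConjugate q) (hα : 1 ≤ α) :
    ∫⁻ x, P.rnDeriv Q x ^ α ∂Q ≤
      (∫⁻ x, P.rnDeriv R x ^ (α * p) ∂(R)) ^ (1 / p) *
        (∫⁻ x, R.rnDeriv Q x ^ ((α - 1 / p) * q) ∂Q) ^ (1 / q) := by
  have hp : 0 < p := hpq.pos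
  have hp' : 0 ≤ 1 / p := by positivity
  have hαp : 0 ≤ α - 1 / p := by
    have : 1 / p ≤ 1 := (div_le_one hp).2 hpq.lt.le
    linarith
  have hf := Measure.measurable_rnDeriv P R
  have hg := Measure.measurable_rnDeriv R Q
  calc ∫⁻ x, P.rnDeriv Q x ^ α ∂Q
      = ∫⁻ x, ((fun x ↦ P.rnDeriv R x ^ α * R.rnDeriv Q x ^ (1 / p)) *
          fun x ↦ R.rnDeriv Q x ^ (α - 1 / p)) x ∂Q := by
        refine lintegral_congr_ae ?_
        filter_upwards [Measure.rnDeriv_mul_rnDeriv (κ := Q) hPR] with x hx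
        rw [← hx, Pi.mul_apply, Pi.mul_apply, ENNReal.mul_rpow_of_nonneg _ _ (by linarith),
          mul_assoc, ← ENNReal.rpow_add_of_nonneg _ _ hp' hαp, add_sub_cancel]
    _ ≤ (∫⁻ x, (P.rnDeriv R x ^ α * R.rnDeriv Q x ^ (1 / p)) ^ p ∂Q) ^ (1 / p) *
          (∫⁻ x, (R.rnDeriv Q x ^ (α - 1 / p)) ^ q ∂Q) ^ (1 / q) :=
        ENNReal.lintegral_mul_le_Lp_mul_Lq Q hpq
          ((hf.pow_const _).mul (hg.pow_const _)).aemeasurable (hg.pow_const _).aemeasurable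
    _ = _ := by
        congr 2
        · rw [← lintegral_rnDeriv_mul hRQ (hf.pow_const _).aemeasurable]
          refine lintegral_congr fun x ↦ ?_
          rw [ENNReal.mul_rpow_of_nonneg _ _ hp.le, ← ENNReal.rpow_mul, ← ENNReal.rpow_mul,
            one_div_mul_cancel hp.ne', ENNReal.rpow_one, mul_comm]
        · exact lintegral_congr fun x ↦ (ENNReal.rpow_mul _ _ _).symm

/-- Weak triangle inequality for Rényi divergence (Bun–Steinke Lemma 5.2). -/
theorem renyiDiv_weak_triangle_inequality {X : Type*} [MeasurableSpace X]
    (P Q R : Measure X)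
    [IsProbabilityMeasure P] [IsProbabilityMeasure Q] [IsProbabilityMeasure R]
    (α k : ℝ) (hα : 1 < α) (hk : 1 < k) :
    renyiDiv α P Q ≤
      ((k * α / (k * α - 1) : ℝ) : EReal) * renyiDiv ((k * α - 1) / (k - 1)) P R
        + renyiDiv (k * α) R Q := by
  have hk0 : 0 < k - 1 := by linarith
  have hα0 : 0 < α - 1 := by linarith
  have hkα : 1 < k * α := by nlinarith
  have hkα0 : 0 < k * α - 1 := by linarith
  have hβ : 1 < (k * α - 1) / (k - 1) := by
    rw [one_lt_div hk0]
    nlinarith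
  have hc : 0 < k * α / (k * α - 1) := by positivity
  by_cases hPR : P ≪ R
  swap
  · rw [show renyiDiv ((k * α - 1) / (k - 1)) P R = ⊤ from if_neg hPR,
      EReal.coe_mul_top_of_pos hc, EReal.top_add_of_ne_bot (renyiDiv_ne_bot R Q hkα)]
    exact le_top
  by_cases hRQ : R ≪ Q
  swap
  · rw [show renyiDiv (k * α) R Q = ⊤ from if_neg hRQ, EReal.add_top_of_ne_bot]
    · exact le_top
    · rw [EReal.mul_ne_bot]
      exact ⟨Or.inl (EReal.coe_ne_bot _), Or.inr (renyiDiv_ne_bot P R hβ),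
        Or.inl (EReal.coe_ne_top _), Or.inl (EReal.coe_nonneg.2 hc.le)⟩
  have hpq : ((k * α - 1) / (α * (k - 1))).HolderConjugate ((k * α - 1) / (α - 1)) := by
    rw [Real.holderConjugate_iff]
    constructor
    · rw [one_lt_div (by positivity)]
      nlinarith
    · field_simp
      ring
  have hH := lintegral_rnDeriv_rpow_le_mul P Q R hPR hRQ hpq hα.le
  rw [show α * ((k * α - 1) / (α * (k - 1))) = (k * α - 1) / (k - 1) by field_simp,
    show (α - 1 / ((k * α - 1) / (α * (k - 1)))) * ((k * α - 1) / (α - 1)) = k * α by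
      rw [one_div_div, sub_div' hkα0.ne', div_mul_div_cancel₀ hkα0.ne', div_eq_iff hα0.ne']
      ring] at hH
  unfold renyiDiv
  rw [if_pos (hPR.trans hRQ), if_pos hPR, if_pos hRQ]
  have hα' : (0 : EReal) ≤ ((α - 1)⁻¹ : ℝ) := EReal.coe_nonneg.2 (by positivity)
  refine (mul_le_mul_of_nonneg_left (ENNReal.log_le_log hH) hα').trans_eq ?_
  rw [ENNReal.log_mul_add, ENNReal.log_rpow, ENNReal.log_rpow,
    EReal.left_distrib_of_nonneg_of_ne_top hα' (EReal.coe_ne_top _),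
    ← mul_assoc, ← mul_assoc, ← mul_assoc, ← EReal.coe_mul, ← EReal.coe_mul, ← EReal.coe_mul]
  have hβ0 : (k * α - 1) / (k - 1) - 1 = k * (α - 1) / (k - 1) := by
    field_simp
    ring
  rw [hβ0]
  congr 3 <;> field_simp
end

section
/- zCDP sequential composition (Theorem 1): Let T be a record set. Let M₁ and M₂ be mechanisms mapping databases over T to probability measures on measurable spaces Y₁ and Y₂, satisfying ρ₁-zCDP and ρ₂-zCDP respectively. Then the joint mechanism M'(D) = M₁(D) ⊗ M₂(D) (the product probability measure on Y₁ × Y₂) satisfies (ρ₁ + ρ₂)-zCDP. -/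
open MeasureTheory ProbabilityTheory
open scoped Classical NNReal

/-- A pair of measures with finite Rényi divergence is absolutely continuous. -/
theorem absolutelyContinuous_of_renyiDiv_ne_top {X : Type*} [MeasurableSpace X] {α : ℝ}
    {P Q : Measure X} (h : renyiDiv α P Q ≠ ⊤) : P ≪ Q := by
  contrapose! h
  exact if_neg h

/-- zCDP sequential composition (Theorem 1). -/
theorem zcdp_sequential_composition {T Y₁ Y₂ : Type*}
    [MeasurableSpace Y₁] [MeasurableSpace Y₂] (ρ₁ ρ₂ : ℝ)
    (M₁ : Multiset T → Measure Y₁) (hM₁prob : ∀ D, IsProbabilityMeasure (M₁ D))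
    (hM₁ : zCDP M₁ ρ₁)
    (M₂ : Multiset T → Measure Y₂) (hM₂prob : ∀ D, IsProbabilityMeasure (M₂ D))
    (hM₂ : zCDP M₂ ρ₂) :
    zCDP (fun D => (M₁ D).prod (M₂ D)) (ρ₁ + ρ₂) := by
  intro α hα D D' r hDD'
  have h₁ := hM₁ α hα D D' r hDD'
  have h₂ := hM₂ α hα D D' r hDD'
  rw [renyiDiv_prod hα
    (absolutelyContinuous_of_renyiDiv_ne_top (h₁.trans_lt (EReal.coe_lt_top _)).ne)
    (absolutelyContinuous_of_renyiDiv_ne_top (h₂.trans_lt (EReal.coe_lt_top _)).ne),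
    add_mul, EReal.coe_add]
  exact add_le_add h₁ h₂
end

section
/- zCDP parallel composition (Theorem 2): Let T be a record set partitioned into two disjoint subsets C₁ and C₂ with C₁ ∪ C₂ = T. Let M₁ and M₂ be mechanisms mapping databases over T to probability measures on measurable spaces Y₁ and Y₂, satisfying ρ₁-zCDP and ρ₂-zCDP respectively. Define M'(D) = M₁(D↾C₁) ⊗ M₂(D↾C₂), where D↾C_i denotes the sub-multiset of D consisting of the records of D lying in C_i. Then M' satisfies max(ρ₁, ρ₂)-zCDP. -/
open MeasureTheory ProbabilityTheory
open scoped Classical NNReal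

/-- If `μ` has density `dP/dQ ∘ g` with respect to `ν` and `g` pushes `ν` forward to `Q`, then the
Rényi divergence of `μ` from `ν` is at most that of `P` from `Q`. -/
theorem renyiDiv_le_of_withDensity_comp {X Y : Type*} [MeasurableSpace X] [MeasurableSpace Y]
    (α : ℝ) {μ ν : Measure X} [SigmaFinite ν] {P Q : Measure Y} {g : X → Y}
    (hg : MeasurePreserving g ν Q)
    (hμ : P ≪ Q → μ = ν.withDensity (fun x => P.rnDeriv Q (g x))) :
    renyiDiv α μ ν ≤ renyiDiv α P Q := by
  by_cases h : P ≪ Q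
  · have hm : Measurable fun x => P.rnDeriv Q (g x) :=
      (Measure.measurable_rnDeriv P Q).comp hg.measurable
    have hac : μ ≪ ν := by
      rw [hμ h]
      exact withDensity_absolutelyContinuous _ _
    have hae : μ.rnDeriv ν =ᵐ[ν] fun x => P.rnDeriv Q (g x) := by
      rw [hμ h]
      exact Measure.rnDeriv_withDensity ν hm
    have hint : ∫⁻ x, μ.rnDeriv ν x ^ α ∂ν = ∫⁻ y, P.rnDeriv Q y ^ α ∂Q := by
      rw [← hg.lintegral_comp ((Measure.measurable_rnDeriv P Q).pow_const α)]
      refine lintegral_congr_ae ?_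
      filter_upwards [hae] with x hx
      rw [hx]
    rw [renyiDiv, renyiDiv, if_pos hac, if_pos h, hint]
  · simp [renyiDiv, h]

theorem renyiDiv_prod_right_le {X Y : Type*} [MeasurableSpace X] [MeasurableSpace Y] (α : ℝ)
    (P P' : Measure X) (Q : Measure Y) [SigmaFinite P] [SigmaFinite P'] [IsProbabilityMeasure Q] :
    renyiDiv α (P.prod Q) (P'.prod Q) ≤ renyiDiv α P P' := by
  refine renyiDiv_le_of_withDensity_comp α measurePreserving_fst fun h => ?_
  rw [← prod_withDensity_left (Measure.measurable_rnDeriv P P'),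
    Measure.withDensity_rnDeriv_eq _ _ h]

theorem renyiDiv_prod_left_le {X Y : Type*} [MeasurableSpace X] [MeasurableSpace Y] (α : ℝ)
    (P : Measure X) (Q Q' : Measure Y) [IsProbabilityMeasure P] [SigmaFinite Q] [SigmaFinite Q'] :
    renyiDiv α (P.prod Q) (P.prod Q') ≤ renyiDiv α Q Q' := by
  refine renyiDiv_le_of_withDensity_comp α measurePreserving_snd fun h => ?_
  rw [← prod_withDensity_right (Measure.measurable_rnDeriv Q Q'),
    Measure.withDensity_rnDeriv_eq _ _ h]

theorem Neighbors.filter_of_pos {T : Type*} {D D' : Multiset T} {r : T} (h : Neighbors D D' r)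
    (p : T → Prop) [DecidablePred p] (hr : p r) : Neighbors (D.filter p) (D'.filter p) r := by
  rcases h with rfl | rfl
  · exact Or.inl (Multiset.filter_cons_of_pos _ hr)
  · exact Or.inr (Multiset.filter_cons_of_pos _ hr)

theorem Neighbors.filter_of_neg {T : Type*} {D D' : Multiset T} {r : T} (h : Neighbors D D' r)
    (p : T → Prop) [DecidablePred p] (hr : ¬ p r) : D.filter p = D'.filter p := by
  rcases h with rfl | rfl <;> simp [hr]

/-- zCDP parallel composition (Theorem 2). -/
theorem zcdp_parallel_composition {T Y₁ Y₂ : Type*}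
    [MeasurableSpace Y₁] [MeasurableSpace Y₂]
    (C₁ C₂ : Set T) [DecidablePred (· ∈ C₁)] [DecidablePred (· ∈ C₂)]
    (hdisj : Disjoint C₁ C₂) (hcover : C₁ ∪ C₂ = Set.univ) (ρ₁ ρ₂ : ℝ)
    (M₁ : Multiset T → Measure Y₁) (hM₁prob : ∀ D, IsProbabilityMeasure (M₁ D))
    (hM₁ : zCDP M₁ ρ₁)
    (M₂ : Multiset T → Measure Y₂) (hM₂prob : ∀ D, IsProbabilityMeasure (M₂ D))
    (hM₂ : zCDP M₂ ρ₂) :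
    zCDP (fun D => (M₁ (D.filter (· ∈ C₁))).prod (M₂ (D.filter (· ∈ C₂))))
      (max ρ₁ ρ₂) := by
  intro α hα D D' r h
  have hle : ∀ {ρ : ℝ}, ρ ≤ max ρ₁ ρ₂ → ((ρ * α : ℝ) : EReal) ≤ ((max ρ₁ ρ₂ * α : ℝ) : EReal) :=
    fun hρ => EReal.coe_le_coe_iff.2 (mul_le_mul_of_nonneg_right hρ (by linarith))
  by_cases hr : r ∈ C₁
  · have hr₂ : r ∉ C₂ := Set.disjoint_left.1 hdisj hr
    dsimp only
    rw [h.filter_of_neg (· ∈ C₂) hr₂]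
    exact (renyiDiv_prod_right_le α _ _ _).trans
      ((hM₁ α hα _ _ r (h.filter_of_pos (· ∈ C₁) hr)).trans (hle (le_max_left _ _)))
  · have hr₂ : r ∈ C₂ := (hcover.ge (Set.mem_univ r)).resolve_left hr
    dsimp only
    rw [h.filter_of_neg (· ∈ C₁) hr]
    exact (renyiDiv_prod_left_le α _ _ _).trans
      ((hM₂ α hα _ _ r (h.filter_of_pos (· ∈ C₂) hr₂)).trans (hle (le_max_right _ _)))
end

section
/- The Gaussian mechanism satisfies zCDP (Definition 5): Let T be a record set, σ > 0, Δ ≥ 0, and let q be a real-valued function on databases over T such that |q(D) − q(D')| ≤ Δ for all databases D, D' differing in a single record. Then the mechanism M that on input D outputs a sample from the Gaussian distribution N(q(D), σ²) on ℝ satisfies (Δ²/(2σ²))-zCDP. -/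
open MeasureTheory ProbabilityTheory
open scoped Classical NNReal

theorem gaussianPDFReal_mul_exp_sub_sq (μ ν x α : ℝ) {v : ℝ≥0} (hv : v ≠ 0) :
    gaussianPDFReal ν v x * Real.exp (α * (((x - ν) ^ 2 - (x - μ) ^ 2) / (2 * v))) =
      Real.exp (α * (α - 1) * (μ - ν) ^ 2 / (2 * v)) *
        gaussianPDFReal (α * μ + (1 - α) * ν) v x := by
  have hv' : (v : ℝ) ≠ 0 := NNReal.coe_ne_zero.mpr hv
  rw [gaussianPDFReal, gaussianPDFReal, mul_assoc, ← Real.exp_add,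
    mul_left_comm (Real.exp _), ← Real.exp_add]
  congr 2
  field_simp
  ring

theorem gaussianReal_eq_withDensity_gaussianReal (μ ν : ℝ) {v : ℝ≥0} (hv : v ≠ 0) :
    gaussianReal μ v = (gaussianReal ν v).withDensity
      (fun x => ENNReal.ofReal (Real.exp (((x - ν) ^ 2 - (x - μ) ^ 2) / (2 * v)))) := by
  rw [gaussianReal_of_var_ne_zero _ hv, gaussianReal_of_var_ne_zero _ hv,
    ← withDensity_mul _ (measurable_gaussianPDF ν v) (by fun_prop)]
  congr 1
  funext x
  rw [Pi.mul_apply, gaussianPDF, gaussianPDF, ← ENNReal.ofReal_mul (gaussianPDFReal_nonneg ..)]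
  have h := gaussianPDFReal_mul_exp_sub_sq μ ν x 1 hv
  simp only [one_mul, sub_self, zero_mul, zero_div, Real.exp_zero, add_zero] at h
  rw [h]

theorem lintegral_rnDeriv_rpow_gaussianReal (μ ν α : ℝ) {v : ℝ≥0} (hv : v ≠ 0) :
    ∫⁻ x, (gaussianReal μ v).rnDeriv (gaussianReal ν v) x ^ α ∂(gaussianReal ν v) =
      ENNReal.ofReal (Real.exp (α * (α - 1) * (μ - ν) ^ 2 / (2 * v))) := by
  have hd : (gaussianReal μ v).rnDeriv (gaussianReal ν v) =ᵐ[gaussianReal ν v]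
      fun x => ENNReal.ofReal (Real.exp (((x - ν) ^ 2 - (x - μ) ^ 2) / (2 * v))) := by
    rw [gaussianReal_eq_withDensity_gaussianReal μ ν hv]
    exact Measure.rnDeriv_withDensity _ (by fun_prop)
  have hpow : (fun x => (gaussianReal μ v).rnDeriv (gaussianReal ν v) x ^ α)
      =ᵐ[gaussianReal ν v] fun x =>
        ENNReal.ofReal (Real.exp (α * (((x - ν) ^ 2 - (x - μ) ^ 2) / (2 * v)))) := by
    filter_upwards [hd] with x hx
    rw [hx, ENNReal.ofReal_rpow_of_pos (Real.exp_pos _), ← Real.exp_mul, mul_comm]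
  rw [lintegral_congr_ae hpow, gaussianReal_of_var_ne_zero _ hv,
    lintegral_withDensity_eq_lintegral_mul _ (measurable_gaussianPDF ν v) (by fun_prop)]
  simp only [Pi.mul_apply, gaussianPDF, ← ENNReal.ofReal_mul (gaussianPDFReal_nonneg ..),
    gaussianPDFReal_mul_exp_sub_sq μ ν _ α hv]
  simp_rw [ENNReal.ofReal_mul (Real.exp_nonneg _)]
  rw [lintegral_const_mul _ (measurable_gaussianPDFReal _ _).ennreal_ofReal,
    lintegral_gaussianPDFReal_eq_one _ hv, mul_one]

theorem renyiDiv_gaussianReal (μ ν : ℝ) {α : ℝ} (hα : 1 < α) {v : ℝ≥0} (hv : v ≠ 0) :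
    renyiDiv α (gaussianReal μ v) (gaussianReal ν v) =
      ((α * (μ - ν) ^ 2 / (2 * v) : ℝ) : EReal) := by
  have hac : gaussianReal μ v ≪ gaussianReal ν v :=
    (gaussianReal_absolutelyContinuous μ hv).trans (gaussianReal_absolutelyContinuous' ν hv)
  rw [renyiDiv, if_pos hac, lintegral_rnDeriv_rpow_gaussianReal μ ν α hv,
    ENNReal.log_ofReal_of_pos (Real.exp_pos _), Real.log_exp, ← EReal.coe_mul]
  have hα' : α - 1 ≠ 0 := sub_ne_zero.mpr hα.ne'
  congr 1
  field_simp

/-- The Gaussian mechanism satisfies zCDP (Definition 5). -/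
theorem gaussian_mechanism_zcdp {T : Type*} (σ : ℝ≥0) (hσ : 0 < σ) (Δ : ℝ) (hΔ : 0 ≤ Δ)
    (q : Multiset T → ℝ)
    (hq : ∀ (D D' : Multiset T) (r : T), Neighbors D D' r → |q D - q D'| ≤ Δ) :
    zCDP (fun D => gaussianReal (q D) (σ ^ 2)) (Δ ^ 2 / (2 * (σ : ℝ) ^ 2)) := by
  intro α hα D D' r h
  have hv : σ ^ 2 ≠ 0 := pow_ne_zero 2 hσ.ne'
  rw [renyiDiv_gaussianReal _ _ hα hv, EReal.coe_le_coe_iff, NNReal.coe_pow, mul_comm α,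
    mul_div_right_comm]
  have hsq : (q D - q D') ^ 2 ≤ Δ ^ 2 := sq_le_sq.mpr ((hq D D' r h).trans (le_abs_self Δ))
  gcongr
end
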